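/- arXiv:2312.16655 — 4 statements merged into one kernel-verified Lean document; each statement's English description precedes it below -/
import Mathlib

section
/- The pair (𝔟⁺, 𝔟⁻) is a transverse pair of parabolic subspaces of 𝔰𝔩ₙ(ℝ), and if V₁ and V₂ are any transverse parabolic subspaces of 𝔰𝔩ₙ(ℝ), then the ordered pair (V₁, V₂) admits a standardizer: there exists h ∈ SLₙ(ℝ) with Ad(h)𝔟⁺ = V₁ and Ad(h)𝔟⁻ = V₂. In particular SLₙ(ℝ) acts transitively on ordered transverse pairs of parabolic subspaces. -/
open Matrix

noncomputable section

abbrev Mn (n : ℕ) := Matrix (Fin n) (Fin n) ℝ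

/-- Conjugation `Z ↦ g Z g⁻¹` as a linear map on matrices. -/
def AdM {n : ℕ} (g : Mn n) : Mn n →ₗ[ℝ] Mn n where
  toFun Z := g * Z * g⁻¹
  map_add' X Y := by simp [Matrix.add_mul, Matrix.mul_add]
  map_smul' c X := by simp [Matrix.smul_mul, Matrix.mul_smul]

/-- Projection onto the diagonal part. -/
def pi0 {n : ℕ} : Mn n →ₗ[ℝ] Mn n where
  toFun Z := Matrix.diagonal (fun i => Z i i)
  map_add' X Y := by
    ext i j
    by_cases h : i = j <;> simp [Matrix.diagonal_apply, h]
  map_smul' c X := by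
    ext i j
    by_cases h : i = j <;> simp [Matrix.diagonal_apply, h]

/-- The involution reversing the diagonal entries (on diagonal matrices). -/
def omega0 {n : ℕ} : Mn n →ₗ[ℝ] Mn n where
  toFun Z := Matrix.diagonal (fun i => Z i.rev i.rev)
  map_add' X Y := by
    ext i j
    by_cases h : i = j <;> simp [Matrix.diagonal_apply, h]
  map_smul' c X := by
    ext i j
    by_cases h : i = j <;> simp [Matrix.diagonal_apply, h]

/-- Traceless matrices: 𝔰𝔩ₙ(ℝ). -/
def slSub (n : ℕ) : Submodule ℝ (Mn n) := LinearMap.ker (Matrix.traceLinearMap (Fin n) ℝ ℝ)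

/-- Matrices vanishing below the diagonal (upper triangular). -/
def upTri (n : ℕ) : Submodule ℝ (Mn n) where
  carrier := {Z | ∀ i j : Fin n, j < i → Z i j = 0}
  add_mem' := by intro a b ha hb i j h; simp [Matrix.add_apply, ha i j h, hb i j h]
  zero_mem' := by intro i j h; rfl
  smul_mem' := by intro c a ha i j h; simp [Matrix.smul_apply, ha i j h]

/-- Matrices vanishing above the diagonal (lower triangular). -/
def loTri (n : ℕ) : Submodule ℝ (Mn n) where
  carrier := {Z | ∀ i j : Fin n, i < j → Z i j = 0}
  add_mem' := by intro a b ha hb i j h; simp [Matrix.add_apply, ha i j h, hb i j h]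
  zero_mem' := by intro i j h; rfl
  smul_mem' := by intro c a ha i j h; simp [Matrix.smul_apply, ha i j h]

/-- Diagonal matrices. -/
def diagSub (n : ℕ) : Submodule ℝ (Mn n) where
  carrier := {Z | ∀ i j : Fin n, i ≠ j → Z i j = 0}
  add_mem' := by intro a b ha hb i j h; simp [Matrix.add_apply, ha i j h, hb i j h]
  zero_mem' := by intro i j h; rfl
  smul_mem' := by intro c a ha i j h; simp [Matrix.smul_apply, ha i j h]

/-- Strictly upper triangular matrices: 𝔫⁺. -/
def nplus (n : ℕ) : Submodule ℝ (Mn n) where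
  carrier := {Z | ∀ i j : Fin n, j ≤ i → Z i j = 0}
  add_mem' := by intro a b ha hb i j h; simp [Matrix.add_apply, ha i j h, hb i j h]
  zero_mem' := by intro i j h; rfl
  smul_mem' := by intro c a ha i j h; simp [Matrix.smul_apply, ha i j h]

/-- Strictly lower triangular matrices: 𝔫⁻. -/
def nminus (n : ℕ) : Submodule ℝ (Mn n) where
  carrier := {Z | ∀ i j : Fin n, i ≤ j → Z i j = 0}
  add_mem' := by intro a b ha hb i j h; simp [Matrix.add_apply, ha i j h, hb i j h]
  zero_mem' := by intro i j h; rfl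
  smul_mem' := by intro c a ha i j h; simp [Matrix.smul_apply, ha i j h]

/-- 𝔟⁺ : traceless upper triangular matrices. -/
def bplus (n : ℕ) : Submodule ℝ (Mn n) := slSub n ⊓ upTri n

/-- 𝔟⁻ : traceless lower triangular matrices. -/
def bminus (n : ℕ) : Submodule ℝ (Mn n) := slSub n ⊓ loTri n

/-- 𝔞 : traceless diagonal matrices. -/
def aSub (n : ℕ) : Submodule ℝ (Mn n) := slSub n ⊓ diagSub n

/-- A parabolic subspace of 𝔰𝔩ₙ(ℝ): a subspace of the form Ad(g)𝔟⁺ with g ∈ SLₙ(ℝ). -/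
def IsParabolic {n : ℕ} (V : Submodule ℝ (Mn n)) : Prop :=
  ∃ g : Mn n, g.det = 1 ∧ V = (bplus n).map (AdM g)

/-- Two subspaces are transverse if together they span 𝔰𝔩ₙ(ℝ). -/
def Transv {n : ℕ} (V W : Submodule ℝ (Mn n)) : Prop := V ⊔ W = slSub n

/-- A standardizer of an ordered transverse pair of parabolic subspaces. -/
def IsStd {n : ℕ} (h : Mn n) (V₁ V₂ : Submodule ℝ (Mn n)) : Prop :=
  h.det = 1 ∧ (bplus n).map (AdM h) = V₁ ∧ (bminus n).map (AdM h) = V₂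

/-- ν*_{i,j} computed with the standardizer h. -/
def nustar {n : ℕ} (h : Mn n) : Mn n →ₗ[ℝ] Mn n := pi0 ∘ₗ AdM h⁻¹

/-- ν_{i,j} computed with the standardizer h. -/
def nuMap {n : ℕ} (h : Mn n) : Mn n →ₗ[ℝ] Mn n := AdM h ∘ₗ pi0

/-- π_{i,j} computed with the standardizer h. -/
def piStd {n : ℕ} (h : Mn n) : Mn n →ₗ[ℝ] Mn n := AdM h ∘ₗ pi0 ∘ₗ AdM h⁻¹

/-- The commutator subspace [V,V]. -/
def commSub {n : ℕ} (V : Submodule ℝ (Mn n)) : Submodule ℝ (Mn n) :=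
  Submodule.span ℝ {z | ∃ x ∈ V, ∃ y ∈ V, z = x * y - y * x}

/-- An affine parabolic space with direction V: an affine subspace X + V of 𝔰𝔩ₙ(ℝ)
whose direction V is a parabolic subspace. -/
def IsAffPara {n : ℕ} (A : Set (Mn n)) (V : Submodule ℝ (Mn n)) : Prop :=
  IsParabolic V ∧ ∃ X : Mn n, X ∈ slSub n ∧ A = {Z | Z - X ∈ V}

/-- `IsCross b A₁ A₂ A₃ A₄ V₁ V₂ V₃ V₄` : b is a value of the affine cross ratio
β(A₁,A₂,A₃,A₄), computed with some choice of standardizers and intersection points. -/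
def IsCross {n : ℕ} (b : Mn n) (A₁ A₂ A₃ A₄ : Set (Mn n))
    (V₁ V₂ V₃ V₄ : Submodule ℝ (Mn n)) : Prop :=
  ∃ h₁₄ h₂₃ : Mn n, ∃ X₁₃ X₂₄ : Mn n,
    IsStd h₁₄ V₁ V₄ ∧ IsStd h₂₃ V₂ V₃ ∧ X₁₃ ∈ A₁ ∩ A₃ ∧ X₂₄ ∈ A₂ ∩ A₄ ∧
    b = nustar h₁₄ (X₁₃ - X₂₄) - nustar h₂₃ (X₁₃ - X₂₄)

/-- `IsTriple d A₂ A₃ A₄ V₂ V₃ V₄` : d is a value of the affine triple ratio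
δ(A₂,A₃,A₄), computed with some choice of standardizers and points. -/
def IsTriple {n : ℕ} (d : Mn n) (A₂ A₃ A₄ : Set (Mn n))
    (V₂ V₃ V₄ : Submodule ℝ (Mn n)) : Prop :=
  ∃ h₂₃ h₃₂ h₃₄ h₄₃ h₄₂ h₂₄ : Mn n, ∃ X₂ X₃ X₄ : Mn n,
    IsStd h₂₃ V₂ V₃ ∧ IsStd h₃₂ V₃ V₂ ∧ IsStd h₃₄ V₃ V₄ ∧ IsStd h₄₃ V₄ V₃ ∧
    IsStd h₄₂ V₄ V₂ ∧ IsStd h₂₄ V₂ V₄ ∧ X₂ ∈ A₂ ∧ X₃ ∈ A₃ ∧ X₄ ∈ A₄ ∧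
    d = (nustar h₂₃ (X₂ - X₃) + nustar h₃₂ (X₂ - X₃))
      + (nustar h₃₄ (X₃ - X₄) + nustar h₄₃ (X₃ - X₄))
      + (nustar h₄₂ (X₄ - X₂) + nustar h₂₄ (X₄ - X₂))

/-- The affine action of (g,Y) ∈ SLₙ(ℝ) ⋉ 𝔰𝔩ₙ(ℝ) on 𝔰𝔩ₙ(ℝ). -/
def affMap {n : ℕ} (g Y : Mn n) : Mn n → Mn n := fun Z => g * Z * g⁻¹ + Y

section AdM

variable {n : ℕ}

theorem AdM_apply (g Z : Mn n) : AdM g Z = g * Z * g⁻¹ := rfl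

theorem mem_slSub {Z : Mn n} : Z ∈ slSub n ↔ Z.trace = 0 := Iff.rfl

theorem mem_bplus {Z : Mn n} : Z ∈ bplus n ↔ Z.trace = 0 ∧ Z.BlockTriangular id := Iff.rfl

theorem mem_bminus {Z : Mn n} :
    Z ∈ bminus n ↔ Z.trace = 0 ∧ Z.BlockTriangular OrderDual.toDual := Iff.rfl

theorem AdM_mul (g h : Mn n) : AdM (g * h) = AdM g ∘ₗ AdM h := by
  ext1 Z
  simp [AdM_apply, Matrix.mul_inv_rev, Matrix.mul_assoc]

theorem map_AdM_mul (g h : Mn n) (V : Submodule ℝ (Mn n)) :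
    V.map (AdM (g * h)) = (V.map (AdM h)).map (AdM g) := by
  rw [AdM_mul, Submodule.map_comp]

theorem map_AdM_one (V : Submodule ℝ (Mn n)) : V.map (AdM 1) = V := by
  have h : AdM (1 : Mn n) = LinearMap.id := by
    ext1 Z
    simp [AdM_apply]
  rw [h, Submodule.map_id]

theorem trace_AdM {g : Mn n} (hg : IsUnit g.det) (Z : Mn n) : (AdM g Z).trace = Z.trace := by
  rw [AdM_apply, Matrix.trace_mul_comm, ← Matrix.mul_assoc, Matrix.nonsing_inv_mul _ hg,
    Matrix.one_mul]

theorem map_AdM_eq_of_le {g : Mn n} (hg : IsUnit g.det) {V W : Submodule ℝ (Mn n)}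
    (h : V.map (AdM g) ≤ W) (h' : W.map (AdM g⁻¹) ≤ V) : V.map (AdM g) = W := by
  refine le_antisymm h ?_
  have := Submodule.map_mono (f := AdM g) h'
  rwa [← map_AdM_mul, Matrix.mul_nonsing_inv _ hg, map_AdM_one] at this

theorem map_AdM_slSub {g : Mn n} (hg : IsUnit g.det) : (slSub n).map (AdM g) = slSub n := by
  refine map_AdM_eq_of_le hg ?_ ?_ <;> rintro _ ⟨Z, hZ, rfl⟩
  · exact (trace_AdM hg Z).trans hZ
  · exact (trace_AdM (Matrix.isUnit_nonsing_inv_det _ hg) Z).trans hZ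

theorem blockTriangular_nonsing_inv {α : Type*} [LinearOrder α] {b : Fin n → α} {u : Mn n}
    (hu : IsUnit u.det) (h : u.BlockTriangular b) : u⁻¹.BlockTriangular b := by
  have := Matrix.invertibleOfIsUnitDet u hu
  exact Matrix.blockTriangular_inv_of_blockTriangular h

theorem map_AdM_bplus_of_upper {u : Mn n} (hu : IsUnit u.det) (h : u.BlockTriangular id) :
    (bplus n).map (AdM u) = bplus n := by
  have hi := blockTriangular_nonsing_inv hu h
  refine map_AdM_eq_of_le hu ?_ ?_ <;> rintro _ ⟨Z, hZ, rfl⟩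
  · exact mem_bplus.2 ⟨(trace_AdM hu Z).trans hZ.1, (h.mul hZ.2).mul hi⟩
  · refine mem_bplus.2 ⟨(trace_AdM (Matrix.isUnit_nonsing_inv_det _ hu) Z).trans hZ.1, ?_⟩
    rw [AdM_apply, Matrix.nonsing_inv_nonsing_inv _ hu]
    exact (hi.mul hZ.2).mul h

theorem map_AdM_bminus_of_lower {l : Mn n} (hl : IsUnit l.det)
    (h : l.BlockTriangular OrderDual.toDual) : (bminus n).map (AdM l) = bminus n := by
  have hi := blockTriangular_nonsing_inv hl h
  refine map_AdM_eq_of_le hl ?_ ?_ <;> rintro _ ⟨Z, hZ, rfl⟩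
  · exact mem_bminus.2 ⟨(trace_AdM hl Z).trans hZ.1, (h.mul hZ.2).mul hi⟩
  · refine mem_bminus.2 ⟨(trace_AdM (Matrix.isUnit_nonsing_inv_det _ hl) Z).trans hZ.1, ?_⟩
    rw [AdM_apply, Matrix.nonsing_inv_nonsing_inv _ hl]
    exact (hi.mul hZ.2).mul h

/-- Conjugation by the antidiagonal permutation matrix exchanges the two triangular subspaces. -/
theorem map_AdM_revPerm_bplus :
    (bplus n).map (AdM ((Fin.revPerm : Equiv.Perm (Fin n)).permMatrix ℝ)) = bminus n := by
  set w : Mn n := (Fin.revPerm : Equiv.Perm (Fin n)).permMatrix ℝ with hw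
  have hww : w * w = 1 := by
    rw [hw, ← Matrix.permMatrix_mul]
    have : (Fin.revPerm : Equiv.Perm (Fin n)) * Fin.revPerm = 1 := by ext; simp
    rw [this, Matrix.permMatrix_one]
  have hinv : w⁻¹ = w := Matrix.inv_eq_left_inv hww
  have hdet : IsUnit w.det := Matrix.isUnit_det_of_left_inverse hww
  have happ (Z : Mn n) (i j : Fin n) : AdM w Z i j = Z i.rev j.rev := by
    rw [AdM_apply, hinv, hw, PEquiv.toMatrix_toPEquiv_mul,
      PEquiv.mul_toMatrix_toPEquiv]
    simp
  refine map_AdM_eq_of_le hdet ?_ ?_ <;> rintro _ ⟨Z, hZ, rfl⟩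
  · refine mem_bminus.2 ⟨(trace_AdM hdet Z).trans hZ.1, fun i j hij => ?_⟩
    rw [happ]
    exact hZ.2 _ _ (Fin.rev_lt_rev.2 hij)
  · rw [hinv]
    refine mem_bplus.2 ⟨(trace_AdM hdet Z).trans hZ.1, fun i j hij => ?_⟩
    rw [happ]
    exact hZ.2 _ _ (Fin.rev_lt_rev.2 hij)

theorem isParabolic_map_AdM_bplus (hn : 0 < n) {g : Mn n} (hg : g.det ≠ 0) :
    IsParabolic ((bplus n).map (AdM g)) := by
  set d : Mn n := Matrix.diagonal (Function.update 1 ⟨0, hn⟩ g.det⁻¹) with hd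
  have hdet : d.det = g.det⁻¹ := by
    rw [hd, Matrix.det_diagonal, Finset.prod_update_of_mem (Finset.mem_univ _)]
    simp
  refine ⟨g * d, by rw [Matrix.det_mul, hdet, mul_inv_cancel₀ hg], ?_⟩
  rw [map_AdM_mul, map_AdM_bplus_of_upper _ (Matrix.blockTriangular_diagonal _)]
  rw [hdet]
  exact (inv_ne_zero hg).isUnit

theorem isParabolic_bplus : IsParabolic (bplus n) :=
  ⟨1, Matrix.det_one, (map_AdM_one _).symm⟩

theorem isParabolic_bminus (hn : 0 < n) : IsParabolic (bminus n) := by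
  rw [← map_AdM_revPerm_bplus]
  refine isParabolic_map_AdM_bplus hn ?_
  rw [Matrix.det_permutation]
  exact_mod_cast (Equiv.Perm.sign _).ne_zero

theorem transv_bplus_bminus : Transv (bplus n) (bminus n) := by
  refine le_antisymm (sup_le inf_le_left inf_le_left) fun Z hZ => ?_
  set L : Mn n := Matrix.of fun i j => if j < i then Z i j else 0 with hL
  have hLtr : L.trace = 0 := by simp [hL, Matrix.trace]
  refine Submodule.mem_sup.2 ⟨Z - L, mem_bplus.2 ⟨?_, fun i j hij => ?_⟩, L,
    mem_bminus.2 ⟨hLtr, fun i j hij => ?_⟩, sub_add_cancel _ _⟩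
  · rw [Matrix.trace_sub, hLtr, mem_slSub.1 hZ, sub_zero]
  · have : j < i := hij
    simp [hL, this]
  · have : i < j := hij
    simp [hL, this.not_gt]

end AdM

section UpperLower

variable {n : ℕ}

/-- The projection onto the span of the basis vectors with index at least `k`. -/
def trailingProj (k : Fin n) : Mn n := Matrix.diagonal fun i => if k ≤ i then 1 else 0

/-- The trailing principal block of `g`, completed by the identity. -/
def trailingBlock (g : Mn n) (k : Fin n) : Mn n :=
  trailingProj k * g * trailingProj k + (1 - trailingProj k)

theorem trailingProj_mul_self (k : Fin n) : trailingProj k * trailingProj k = trailingProj k := by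
  simp [trailingProj]

theorem vecMul_trailingProj (k : Fin n) (v : Fin n → ℝ) (i : Fin n) :
    (v ᵥ* trailingProj k) i = if k ≤ i then v i else 0 := by
  simp [trailingProj, Matrix.vecMul_diagonal]

theorem trailingProj_mulVec (k : Fin n) (v : Fin n → ℝ) (i : Fin n) :
    (trailingProj k *ᵥ v) i = if k ≤ i then v i else 0 := by
  simp [trailingProj, Matrix.mulVec_diagonal]

theorem trailingBlock_mul_trailingProj (g : Mn n) (k : Fin n) :
    trailingBlock g k * trailingProj k = trailingProj k * g * trailingProj k := by
  simp [trailingBlock, Matrix.add_mul, Matrix.sub_mul, Matrix.mul_assoc, trailingProj_mul_self]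

theorem trailingProj_mul_trailingBlock (g : Mn n) (k : Fin n) :
    trailingProj k * trailingBlock g k = trailingProj k * g * trailingProj k := by
  simp [trailingBlock, Matrix.mul_add, Matrix.mul_sub, ← Matrix.mul_assoc, trailingProj_mul_self]

theorem trailingBlock_mul_one_sub (g : Mn n) (k : Fin n) :
    trailingBlock g k * (1 - trailingProj k) = 1 - trailingProj k := by
  rw [Matrix.mul_sub, trailingBlock_mul_trailingProj, trailingBlock]
  simp

theorem one_sub_mul_trailingBlock (g : Mn n) (k : Fin n) :
    (1 - trailingProj k) * trailingBlock g k = 1 - trailingProj k := by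
  rw [Matrix.sub_mul, trailingProj_mul_trailingBlock, trailingBlock]
  simp

/-- An upper triangular matrix preserves the span of the basis vectors with index below `k`,
and a lower triangular one the span of those with index at least `k`. If the trailing block of `g`
were singular, some nonzero `v` and `y` would satisfy `v ⬝ᵥ Z *ᵥ y = 0` for all traceless `Z`. -/
theorem det_trailingBlock_ne_zero {g : Mn n} (hg : IsUnit g.det)
    (h : slSub n ≤ bplus n ⊔ (bminus n).map (AdM g)) (k : Fin n) :
    (trailingBlock g k).det ≠ 0 := by
  intro h0
  obtain ⟨v, hv0, hv⟩ := Matrix.exists_vecMul_eq_zero_iff.2 h0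
  obtain ⟨x, hx0, hx⟩ := Matrix.exists_mulVec_eq_zero_iff.2 h0
  have hvE : v ᵥ* trailingProj k = v := by
    have : v ᵥ* (1 - trailingProj k) = 0 := by
      rw [← trailingBlock_mul_one_sub g k, ← Matrix.vecMul_vecMul, hv, Matrix.zero_vecMul]
    rw [Matrix.vecMul_sub, Matrix.vecMul_one] at this
    exact (sub_eq_zero.1 this).symm
  have hxE : trailingProj k *ᵥ x = x := by
    have : (1 - trailingProj k) *ᵥ x = 0 := by
      rw [← one_sub_mul_trailingBlock g k, ← Matrix.mulVec_mulVec, hx, Matrix.mulVec_zero]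
    rw [Matrix.sub_mulVec, Matrix.one_mulVec] at this
    exact (sub_eq_zero.1 this).symm
  have hvg : (v ᵥ* g) ᵥ* trailingProj k = 0 := by
    have : v ᵥ* (trailingProj k * g * trailingProj k) = 0 := by
      rw [← trailingBlock_mul_trailingProj, ← Matrix.vecMul_vecMul, hv, Matrix.zero_vecMul]
    rwa [← Matrix.vecMul_vecMul, ← Matrix.vecMul_vecMul, hvE] at this
  have hgx : trailingProj k *ᵥ (g *ᵥ x) = 0 := by
    have : (trailingProj k * g * trailingProj k) *ᵥ x = 0 := by
      rw [← trailingProj_mul_trailingBlock, ← Matrix.mulVec_mulVec, hx, Matrix.mulVec_zero]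
    rwa [← Matrix.mulVec_mulVec, hxE, ← Matrix.mulVec_mulVec] at this
  have hv_lt (i : Fin n) (hi : i < k) : v i = 0 := by
    rw [← hvE, vecMul_trailingProj, if_neg hi.not_ge]
  have hx_lt (i : Fin n) (hi : i < k) : x i = 0 := by
    rw [← hxE, trailingProj_mulVec, if_neg hi.not_ge]
  have hvg_ge (i : Fin n) (hi : k ≤ i) : (v ᵥ* g) i = 0 := by
    simpa [vecMul_trailingProj, hi] using congrFun hvg i
  have hgx_ge (i : Fin n) (hi : k ≤ i) : (g *ᵥ x) i = 0 := by
    simpa [trailingProj_mulVec, hi] using congrFun hgx i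
  set y := g *ᵥ x with hy
  have hy0 : y ≠ 0 := by
    intro hy0
    apply hx0
    have := congrArg (g⁻¹ *ᵥ ·) hy0
    simpa [hy, Matrix.mulVec_mulVec, Matrix.nonsing_inv_mul _ hg] using this
  have hvan : ∀ Z ∈ slSub n, v ⬝ᵥ Z *ᵥ y = 0 := by
    intro Z hZ
    obtain ⟨A, hA, _, ⟨B, hB, rfl⟩, rfl⟩ := Submodule.mem_sup.1 (h hZ)
    rw [Matrix.add_mulVec, dotProduct_add]
    have h1 : v ⬝ᵥ A *ᵥ y = 0 := by
      refine Finset.sum_eq_zero fun i _ => ?_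
      rcases lt_or_ge i k with hi | hi
      · rw [hv_lt i hi, zero_mul]
      · refine mul_eq_zero_of_right _ ?_
        rw [Matrix.mulVec, dotProduct]
        refine Finset.sum_eq_zero fun j _ => ?_
        rcases lt_or_ge j k with hj | hj
        · rw [hA.2 i j (hj.trans_le hi), zero_mul]
        · rw [hgx_ge j hj, mul_zero]
    have h2 : v ⬝ᵥ AdM g B *ᵥ y = 0 := by
      have : AdM g B *ᵥ y = g *ᵥ (B *ᵥ x) := by
        rw [AdM_apply, hy, Matrix.mulVec_mulVec, Matrix.mul_assoc, Matrix.nonsing_inv_mul _ hg,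
          Matrix.mul_one, Matrix.mulVec_mulVec]
      rw [this, Matrix.dotProduct_mulVec]
      refine Finset.sum_eq_zero fun i _ => ?_
      rcases lt_or_ge i k with hi | hi
      · refine mul_eq_zero_of_right _ ?_
        rw [Matrix.mulVec, dotProduct]
        refine Finset.sum_eq_zero fun j _ => ?_
        rcases lt_or_ge j k with hj | hj
        · rw [hx_lt j hj, mul_zero]
        · rw [hB.2 i j (hi.trans_le hj), zero_mul]
      · rw [hvg_ge i hi, zero_mul]
    rw [h1, h2, add_zero]
  have hvy : v ⬝ᵥ y = 0 := by
    refine Finset.sum_eq_zero fun i _ => ?_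
    rcases lt_or_ge i k with hi | hi
    · rw [hv_lt i hi, zero_mul]
    · rw [hgx_ge i hi, mul_zero]
  have := hvan (Matrix.vecMulVec v y) (by rw [mem_slSub, Matrix.trace_vecMulVec, hvy])
  rw [Matrix.vecMulVec_mulVec] at this
  simp [dotProduct_smul, hv0, hy0] at this

/-- If all trailing principal blocks of `g` are nonsingular, then some upper triangular matrix
brings `g` to lower unitriangular form. -/
theorem exists_upper_mul_eq_lower {g : Mn n} (h : ∀ k, (trailingBlock g k).det ≠ 0) :
    ∃ p : Mn n, p.BlockTriangular id ∧ (p * g).BlockTriangular OrderDual.toDual ∧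
      (p * g).det = 1 := by
  let p : Mn n := Matrix.of fun k => Pi.single k 1 ᵥ* (trailingBlock g k)⁻¹
  have hp (k : Fin n) : p k ᵥ* trailingBlock g k = Pi.single k 1 := by
    change (Pi.single k 1 ᵥ* (trailingBlock g k)⁻¹) ᵥ* trailingBlock g k = _
    rw [Matrix.vecMul_vecMul, Matrix.nonsing_inv_mul _ (h k).isUnit, Matrix.vecMul_one]
  have hsingle (k : Fin n) : (Pi.single k 1 : Fin n → ℝ) ᵥ* trailingProj k = Pi.single k 1 := by
    ext i
    rw [vecMul_trailingProj]
    by_cases hi : i = k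
    · simp [hi]
    · simp [hi]
  have hpE (k : Fin n) : p k ᵥ* trailingProj k = p k := by
    have : p k ᵥ* (1 - trailingProj k) = 0 := by
      rw [← trailingBlock_mul_one_sub g k, ← Matrix.vecMul_vecMul, hp, Matrix.vecMul_sub,
        Matrix.vecMul_one, hsingle, sub_self]
    rw [Matrix.vecMul_sub, Matrix.vecMul_one] at this
    exact (sub_eq_zero.1 this).symm
  have hpg (k : Fin n) : (p k ᵥ* g) ᵥ* trailingProj k = Pi.single k 1 := by
    have : p k ᵥ* (trailingProj k * g * trailingProj k) = Pi.single k 1 := by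
      rw [← trailingBlock_mul_trailingProj, ← Matrix.vecMul_vecMul, hp, hsingle]
    rwa [← Matrix.vecMul_vecMul, ← Matrix.vecMul_vecMul, hpE] at this
  have hentry (i j : Fin n) (hij : i ≤ j) : (p * g) i j = (Pi.single i 1 : Fin n → ℝ) j := by
    rw [← hpg i, vecMul_trailingProj, if_pos hij, Matrix.mul_apply_eq_vecMul]
  have hlow : (p * g).BlockTriangular OrderDual.toDual := by
    intro i j hij
    have hij : i < j := hij
    rw [hentry i j hij.le, Pi.single_eq_of_ne hij.ne']
  refine ⟨p, fun i j hij => ?_, hlow, ?_⟩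
  · have hij : j < i := hij
    rw [← hpE i, vecMul_trailingProj, if_neg hij.not_ge]
  · rw [Matrix.det_of_isLowerTriangular _ hlow]
    exact Finset.prod_eq_one fun i _ => by rw [hentry i i le_rfl, Pi.single_eq_same]

end UpperLower

theorem exists_isStd_of_transv {n : ℕ} (hn : 0 < n) {V₁ V₂ : Submodule ℝ (Mn n)}
    (h₁ : IsParabolic V₁) (h₂ : IsParabolic V₂) (h : Transv V₁ V₂) :
    ∃ h : Mn n, IsStd h V₁ V₂ := by
  obtain ⟨a, ha, rfl⟩ := h₁
  obtain ⟨b, hb, rfl⟩ := h₂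
  obtain ⟨c, hc, hbm⟩ := isParabolic_bminus hn
  have hua : IsUnit a.det := by simp [ha]
  have huc : IsUnit c.det := by simp [hc]
  have hplus : bplus n = (bminus n).map (AdM c⁻¹) := by
    rw [hbm, ← map_AdM_mul, Matrix.nonsing_inv_mul _ huc, map_AdM_one]
  set g : Mn n := a⁻¹ * (b * c⁻¹) with hg
  have hgdet : g.det = 1 := by simp [hg, ha, hb, hc, Matrix.det_nonsing_inv]
  have hag : a * g = b * c⁻¹ := Matrix.mul_nonsing_inv_cancel_left _ _ hua
  have hV₂ : (bplus n).map (AdM b) = (bminus n).map (AdM (a * g)) := by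
    rw [hag, map_AdM_mul, ← hplus]
  have hsl : slSub n ≤ bplus n ⊔ (bminus n).map (AdM g) := by
    have := congrArg (Submodule.map (AdM a⁻¹)) h
    rw [hV₂, Submodule.map_sup, ← map_AdM_mul, ← map_AdM_mul,
      Matrix.nonsing_inv_mul_cancel_left _ _ hua, Matrix.nonsing_inv_mul _ hua, map_AdM_one,
      map_AdM_slSub (Matrix.isUnit_nonsing_inv_det _ hua)] at this
    exact this.ge
  obtain ⟨p, hp, hpg, hdet⟩ := exists_upper_mul_eq_lower
    (det_trailingBlock_ne_zero (by simp [hgdet]) hsl)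
  have hpdet : p.det = 1 := by simpa [Matrix.det_mul, hgdet] using hdet
  have hup : IsUnit p.det := by simp [hpdet]
  refine ⟨a * p⁻¹, by simp [Matrix.det_nonsing_inv, ha, hpdet], ?_, ?_⟩
  · rw [map_AdM_mul, map_AdM_bplus_of_upper (Matrix.isUnit_nonsing_inv_det _ hup)
      (blockTriangular_nonsing_inv hup hp)]
  · rw [hV₂, ← Matrix.nonsing_inv_mul_cancel_left p g hup, ← Matrix.mul_assoc a,
      map_AdM_mul _ (p * g), map_AdM_bminus_of_lower (by simp [hdet]) hpg]

/-- The pair (𝔟⁺, 𝔟⁻) is a transverse pair of parabolic subspaces of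
𝔰𝔩ₙ(ℝ), and any ordered transverse pair of parabolic subspaces admits a standardizer;
in particular SLₙ(ℝ) acts transitively on ordered transverse pairs of parabolic
subspaces. -/
theorem transverse_pairs_admit_standardizers (n : ℕ) (hn : 2 ≤ n) :
    (IsParabolic (bplus n) ∧ IsParabolic (bminus n) ∧ Transv (bplus n) (bminus n)) ∧
    ∀ V₁ V₂ : Submodule ℝ (Mn n), IsParabolic V₁ → IsParabolic V₂ → Transv V₁ V₂ →
      ∃ h : Mn n, IsStd h V₁ V₂ := by
  have hn' : 0 < n := by omega
  exact ⟨⟨isParabolic_bplus, isParabolic_bminus hn', transv_bplus_bminus⟩,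
    fun _ _ h₁ h₂ h => exists_isStd_of_transv hn' h₁ h₂ h⟩

end
end

section
/- Let V_i, V_j, V_k be pairwise transverse parabolic subspaces of 𝔰𝔩ₙ(ℝ), and let h_{i,j}, h_{i,k}, h_{k,j} ∈ SLₙ(ℝ) be standardizers of the ordered pairs (V_i,V_j), (V_i,V_k), (V_k,V_j) respectively. Then for every Y ∈ 𝔞 one has Ad(h_{i,k})Y − Ad(h_{i,j})Y ∈ V_iᵘ and Ad(h_{k,j})Y − Ad(h_{i,j})Y ∈ V_jᵘ. -/
open Matrix

noncomputable section

section BlockTriangular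

variable {n : ℕ} {α : Type*} [LinearOrder α] {b : Fin n → α}

/-- An invertible matrix whose conjugation preserves the matrices that are triangular for an
ordering of the indices is itself triangular. -/
theorem blockTriangular_of_conj {g : Mn n} (hg : IsUnit g.det)
    (H : ∀ Z : Mn n, Z.BlockTriangular b → (g * Z * g⁻¹).BlockTriangular b) :
    g.BlockTriangular b := by
  by_contra hcon
  let S : Finset (Fin n) := Finset.univ.filter fun p => ∃ i, b p < b i ∧ g i p ≠ 0
  have hS : S.Nonempty := by
    simp only [Matrix.BlockTriangular, not_forall] at hcon
    obtain ⟨i, p, hpi, hne⟩ := hcon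
    exact ⟨p, by simpa [S] using ⟨i, hpi, hne⟩⟩
  obtain ⟨p, hpS, hmin⟩ := S.exists_min_image b hS
  obtain ⟨i, hpi, hne⟩ := (Finset.mem_filter.1 hpS).2
  have hinv : ∀ q, b p ≤ b q → g⁻¹ q p = 0 := by
    intro q hpq
    have hZ : (Matrix.single p q (1 : ℝ)).BlockTriangular b :=
      Matrix.blockTriangular_single hpq 1
    have := H _ hZ hpi
    rw [Matrix.mul_assoc, Matrix.mul_apply, Finset.sum_eq_single p] at this
    · simpa [hne] using this
    · intro k _ hk
      simp [hk]
    · simp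
  have hone : (g * g⁻¹) p p = 1 := by rw [Matrix.mul_nonsing_inv g hg]; simp
  rw [Matrix.mul_apply, Finset.sum_eq_zero] at hone
  · exact zero_ne_one hone
  · intro q _
    rcases le_or_gt (b p) (b q) with hpq | hqp
    · rw [hinv q hpq, mul_zero]
    · have hq : g p q = 0 := by
        by_contra hq
        exact absurd (hmin q (Finset.mem_filter.2 ⟨Finset.mem_univ _, p, hqp, hq⟩))
          (not_le.2 hqp)
      rw [hq, zero_mul]

/-- Conjugating a diagonal matrix by a triangular one changes it only by a
strictly triangular matrix. -/
theorem conj_sub_apply_eq_zero {g Y : Mn n} (hb : Function.Injective b) (hg : IsUnit g.det)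
    (hgb : g.BlockTriangular b) (hY : Y ∈ diagSub n) {i j : Fin n} (hji : b j ≤ b i) :
    (g * Y * g⁻¹ - Y) i j = 0 := by
  have hginv : g⁻¹.BlockTriangular b := by
    have := g.invertibleOfIsUnitDet hg
    exact Matrix.blockTriangular_inv_of_blockTriangular hgb
  have hYd : Y = Matrix.diagonal fun k => Y k k := by
    ext k l
    by_cases hkl : k = l
    · simp [hkl]
    · rw [Matrix.diagonal_apply_ne _ hkl, hY k l hkl]
  have hfac : g * Y * g⁻¹ - Y = (g * Y - Y * g) * g⁻¹ := by
    rw [Matrix.sub_mul, Matrix.mul_nonsing_inv_cancel_right _ _ hg]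
  rw [hfac, Matrix.mul_apply]
  refine Finset.sum_eq_zero fun k _ => ?_
  have hcomm : (g * Y - Y * g) i k = g i k * (Y k k - Y i i) := by
    rw [Matrix.sub_apply, hYd, Matrix.mul_diagonal, Matrix.diagonal_mul]
    simp only [Matrix.diagonal_apply_eq]
    ring
  rw [hcomm]
  rcases lt_trichotomy (b k) (b i) with h | h | h
  · rw [hgb h]; ring
  · rw [hb h]; ring
  · rw [hginv (hji.trans_lt h)]; ring

/-- Strictly triangular matrices lie in the commutator of the traceless triangular ones. -/
theorem mem_commSub_of_strictly_triangular {W : Submodule ℝ (Mn n)}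
    (hW : ∀ Z, Z ∈ W ↔ Z.trace = 0 ∧ Z.BlockTriangular b) {N : Mn n}
    (hN : ∀ i j, b j ≤ b i → N i j = 0) : N ∈ commSub W := by
  rw [Matrix.matrix_eq_sum_single N]
  refine Submodule.sum_mem _ fun p _ => Submodule.sum_mem _ fun q _ => ?_
  rcases le_or_gt (b q) (b p) with hqp | hpq
  · rw [hN p q hqp, Matrix.single_zero]
    exact Submodule.zero_mem _
  · have hne : p ≠ q := fun h => by simp [h] at hpq
    refine Submodule.subset_span
      ⟨Matrix.single p p (1 / 2) - Matrix.single q q (1 / 2), (hW _).2 ⟨?_, ?_⟩,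
        Matrix.single p q (N p q), (hW _).2 ⟨?_, ?_⟩, ?_⟩
    · simp [Matrix.trace_sub]
    · exact (Matrix.blockTriangular_single le_rfl _).sub
        (Matrix.blockTriangular_single le_rfl _)
    · exact Matrix.trace_single_eq_of_ne _ _ _ hne
    · exact Matrix.blockTriangular_single hpq.le _
    · rw [Matrix.sub_mul, Matrix.mul_sub, Matrix.single_mul_single_same,
        Matrix.single_mul_single_of_ne _ _ _ _ hne.symm,
        Matrix.single_mul_single_of_ne _ _ _ _ hne.symm, Matrix.single_mul_single_same,
        sub_zero, zero_sub, sub_neg_eq_add, ← Matrix.single_add]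
      congr 1
      ring

theorem AdM_mem_commSub_map {W : Submodule ℝ (Mn n)} {h N : Mn n} (hh : IsUnit h.det)
    (hN : N ∈ commSub W) : AdM h N ∈ commSub (W.map (AdM h)) := by
  induction hN using Submodule.span_induction with
  | mem z hz =>
    obtain ⟨x, hx, y, hy, rfl⟩ := hz
    refine Submodule.subset_span ⟨AdM h x, ⟨x, hx, rfl⟩, AdM h y, ⟨y, hy, rfl⟩, ?_⟩
    have key : ∀ u v : Mn n, h * (u * v) * h⁻¹ = h * u * h⁻¹ * (h * v * h⁻¹) := by
      intro u v
      simp only [Matrix.mul_assoc, Matrix.nonsing_inv_mul_cancel_left _ _ hh]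
    rw [map_sub]
    exact congrArg₂ (· - ·) (key x y) (key y x)
  | zero => rw [map_zero]; exact Submodule.zero_mem _
  | add x y _ _ hx hy => rw [map_add]; exact Submodule.add_mem _ hx hy
  | smul c x _ hx => rw [map_smul]; exact Submodule.smul_mem _ c hx

/-- Two elements conjugating the traceless triangular matrices to the same subspace have
adjoint actions on diagonal matrices that agree modulo the commutator of that subspace. -/
theorem AdM_sub_AdM_mem_commSub {W : Submodule ℝ (Mn n)} (hb : Function.Injective b)
    (hW : ∀ Z, Z ∈ W ↔ Z.trace = 0 ∧ Z.BlockTriangular b) {h h' Y : Mn n}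
    (hh : IsUnit h.det) (hh' : IsUnit h'.det) (hmap : W.map (AdM h') = W.map (AdM h))
    (hY : Y ∈ diagSub n) : AdM h' Y - AdM h Y ∈ commSub (W.map (AdM h)) := by
  have hg : IsUnit (h⁻¹ * h').det := by
    rw [Matrix.det_mul]
    exact (Matrix.isUnit_nonsing_inv_det h hh).mul hh'
  have hginv : (h⁻¹ * h')⁻¹ = h'⁻¹ * h := by
    rw [Matrix.mul_inv_rev, Matrix.nonsing_inv_nonsing_inv h hh]
  have hconj : ∀ Z : Mn n, h⁻¹ * h' * Z * (h⁻¹ * h')⁻¹ = h⁻¹ * (h' * Z * h'⁻¹) * h := by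
    intro Z
    simp only [hginv, Matrix.mul_assoc]
  have htraceless : ∀ Z ∈ W, (h⁻¹ * h' * Z * (h⁻¹ * h')⁻¹).BlockTriangular b := by
    intro Z hZ
    have hmem : AdM h' Z ∈ W.map (AdM h) := hmap ▸ Submodule.mem_map_of_mem hZ
    obtain ⟨Z', hZ', heq⟩ := hmem
    change h * Z' * h⁻¹ = h' * Z * h'⁻¹ at heq
    rw [hconj, ← heq]
    have : h⁻¹ * (h * Z' * h⁻¹) * h = Z' := by
      simp only [Matrix.mul_assoc, Matrix.nonsing_inv_mul_cancel_left _ _ hh,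
        Matrix.nonsing_inv_mul _ hh, Matrix.mul_one]
    rw [this]
    exact ((hW Z').1 hZ').2
  have htri : (h⁻¹ * h').BlockTriangular b := by
    refine blockTriangular_of_conj hg fun Z hZ => ?_
    rcases Nat.eq_zero_or_pos n with rfl | hn
    · exact fun i => i.elim0
    have hn' : (n : ℝ) ≠ 0 := by exact_mod_cast hn.ne'
    set c : ℝ := Z.trace / n with hc
    have hone : (c • (1 : Mn n)).BlockTriangular b := by
      intro i j hij
      have : i ≠ j := fun h => by simp [h] at hij
      simp [Matrix.one_apply_ne this]
    have hmem : Z - c • (1 : Mn n) ∈ W := by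
      refine (hW _).2 ⟨?_, hZ.sub hone⟩
      rw [Matrix.trace_sub, Matrix.trace_smul, Matrix.trace_one, Fintype.card_fin, hc,
        smul_eq_mul, div_mul_cancel₀ _ hn', sub_self]
    have hsum := (htraceless _ hmem).add hone
    rwa [Matrix.mul_sub, Matrix.sub_mul, Matrix.mul_smul, Matrix.mul_one, Matrix.smul_mul,
      Matrix.mul_nonsing_inv _ hg, sub_add_cancel] at hsum
  have hN := mem_commSub_of_strictly_triangular hW
    fun i j hji => conj_sub_apply_eq_zero hb hg htri hY (i := i) (j := j) hji
  have hfinal := AdM_mem_commSub_map hh hN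
  have heq : AdM h (h⁻¹ * h' * Y * (h⁻¹ * h')⁻¹) = AdM h' Y := by
    change h * (h⁻¹ * h' * Y * (h⁻¹ * h')⁻¹) * h⁻¹ = h' * Y * h'⁻¹
    simp only [hginv, Matrix.mul_assoc, Matrix.mul_nonsing_inv_cancel_left _ _ hh,
      Matrix.mul_nonsing_inv _ hh, Matrix.mul_one]
  rwa [map_sub, heq] at hfinal

end BlockTriangular

theorem mem_bplus_iff {n : ℕ} (Z : Mn n) :
    Z ∈ bplus n ↔ Z.trace = 0 ∧ Z.BlockTriangular id :=
  Iff.rfl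

theorem mem_bminus_iff {n : ℕ} (Z : Mn n) :
    Z ∈ bminus n ↔ Z.trace = 0 ∧ Z.BlockTriangular OrderDual.toDual :=
  Iff.rfl

/-- Let V_i, V_j, V_k be pairwise transverse parabolic subspaces of
𝔰𝔩ₙ(ℝ), with standardizers h_{i,j}, h_{i,k}, h_{k,j} of the ordered pairs (V_i,V_j),
(V_i,V_k), (V_k,V_j). Then for every Y ∈ 𝔞 one has
Ad(h_{i,k})Y − Ad(h_{i,j})Y ∈ V_iᵘ and Ad(h_{k,j})Y − Ad(h_{i,j})Y ∈ V_jᵘ. -/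
theorem neutral_maps_differ_by_unipotent_directions (n : ℕ) (hn : 2 ≤ n)
    (Vi Vj Vk : Submodule ℝ (Mn n))
    (hVi : IsParabolic Vi) (hVj : IsParabolic Vj) (hVk : IsParabolic Vk)
    (hij' : Transv Vi Vj) (hik' : Transv Vi Vk) (hkj' : Transv Vk Vj)
    (hij hik hkj : Mn n)
    (h₁ : IsStd hij Vi Vj) (h₂ : IsStd hik Vi Vk) (h₃ : IsStd hkj Vk Vj) :
    ∀ Y ∈ aSub n,
      AdM hik Y - AdM hij Y ∈ commSub Vi ∧ AdM hkj Y - AdM hij Y ∈ commSub Vj := by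
  intro Y hY
  obtain ⟨hd₁, rfl, rfl⟩ := h₁
  obtain ⟨hd₂, hm₂, -⟩ := h₂
  obtain ⟨hd₃, -, hm₃⟩ := h₃
  have hu : ∀ {h : Mn n}, h.det = 1 → IsUnit h.det := fun hd => hd ▸ isUnit_one
  exact ⟨AdM_sub_AdM_mem_commSub Function.injective_id mem_bplus_iff (hu hd₁) (hu hd₂) hm₂ hY.2,
    AdM_sub_AdM_mem_commSub OrderDual.toDual.injective mem_bminus_iff (hu hd₁) (hu hd₃) hm₃ hY.2⟩

end
end

section
/- Let V_i, V_j, V_k be pairwise transverse parabolic subspaces of 𝔰𝔩ₙ(ℝ), with standardizers chosen for the ordered pairs (V_i,V_j), (V_i,V_k) and (V_k,V_j). Then ν*_{i,j} = ν*_{i,k} ∘ π_{i,j} and ν_{i,j} = π_{i,j} ∘ ν_{i,k}, and also ν*_{i,j} = ν*_{k,j} ∘ π_{i,j} and ν_{i,j} = π_{i,j} ∘ ν_{k,j}. -/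
open Matrix

noncomputable section

/-- An invertible matrix whose conjugation action preserves block triangular matrices is
block triangular. -/
theorem blockTriangular_of_conj_s8 {m α : Type*} [Fintype m] [DecidableEq m] [LinearOrder α]
    {b : m → α} {g g' : Matrix m m ℝ} (hg' : g'.det ≠ 0)
    (H : ∀ X : Matrix m m ℝ, X.BlockTriangular b → (g' * X * g).BlockTriangular b) :
    g.BlockTriangular b := by
  intro i j hij
  by_contra hne
  have hzero : ∀ a p, b a ≤ b i → b j < b p → g' p a = 0 := by
    intro a p ha hp
    have hX : (Matrix.single a i (1 : ℝ)).BlockTriangular b := by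
      intro x y hxy
      rw [Matrix.single_apply_of_ne]
      rintro ⟨rfl, rfl⟩
      exact absurd hxy (not_lt.mpr ha)
    have h := H _ hX hp
    simpa [Matrix.mul_apply, Matrix.single_apply, ite_and, hne] using h
  apply hg'
  rw [Matrix.det_apply]
  refine Finset.sum_eq_zero fun σ _ => ?_
  suffices h : ∃ a, g' (σ a) a = 0 by
    obtain ⟨a, ha⟩ := h
    exact (congrArg _ (Finset.prod_eq_zero (f := fun a => g' (σ a) a)
      (Finset.mem_univ a) ha)).trans (smul_zero _)
  by_contra! hσ
  have hle : (Finset.univ.filter fun a => b a ≤ b i).card ≤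
      (Finset.univ.filter fun p => b p ≤ b j).card := by
    refine Finset.card_le_card_of_injOn σ (fun a ha => ?_) σ.injective.injOn
    have ha' : b a ≤ b i := by simpa using ha
    by_contra hn
    exact hσ a (hzero a (σ a) ha' (by simpa using hn))
  have hlt : (Finset.univ.filter fun p => b p ≤ b j).card <
      (Finset.univ.filter fun a => b a ≤ b i).card := by
    refine Finset.card_lt_card ((Finset.ssubset_iff_of_subset fun p hp => ?_).2 ⟨i, ?_, ?_⟩)
    · have hp' : b p ≤ b j := by simpa using hp
      simpa using hp'.trans hij.le
    · simp
    · simpa using hij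
  exact absurd hle (not_le.mpr hlt)

/-- Conjugating a diagonal matrix by a triangular matrix does not change the diagonal. -/
theorem pi0_conj_pi0 {n : ℕ} {α : Type*} [LinearOrder α] {b : Fin n → α}
    (hb : Function.Injective b) {g g' : Mn n} (hg : g.BlockTriangular b)
    (hg' : g'.BlockTriangular b) (hgg' : g * g' = 1) (Z : Mn n) :
    pi0 (g * pi0 Z * g') = pi0 Z := by
  refine congrArg Matrix.diagonal (funext fun i => ?_)
  have h1 : ∑ k, g i k * g' k i = 1 := by
    rw [← Matrix.mul_apply, hgg', Matrix.one_apply_eq]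
  rw [Matrix.mul_apply, ← mul_one (Z i i), ← h1, Finset.mul_sum]
  refine Finset.sum_congr rfl fun k _ => ?_
  simp only [pi0, LinearMap.coe_mk, AddHom.coe_mk, Matrix.mul_diagonal]
  rcases lt_trichotomy (b i) (b k) with h | h | h
  · simp [hg' h]
  · rw [hb h]; ring
  · simp [hg h]

/-- Inclusion of conjugates of traceless triangular matrices extends to all triangular
matrices. -/
theorem conj_mem_of_map_le {n : ℕ} (hn : n ≠ 0) {T : Submodule ℝ (Mn n)} (hT : 1 ∈ T)
    {h k : Mn n} (hh : h.det = 1) (hk : k.det = 1)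
    (hle : (slSub n ⊓ T).map (AdM h) ≤ (slSub n ⊓ T).map (AdM k)) {X : Mn n} (hX : X ∈ T) :
    (k⁻¹ * h) * X * (h⁻¹ * k) ∈ T := by
  have hn' : (n : ℝ) ≠ 0 := Nat.cast_ne_zero.mpr hn
  have hhu : IsUnit h.det := by simp [hh]
  have hku : IsUnit k.det := by simp [hk]
  set c : ℝ := X.trace / n
  have hX0 : X - c • (1 : Mn n) ∈ slSub n ⊓ T := by
    refine ⟨?_, T.sub_mem hX (T.smul_mem c hT)⟩
    simp [slSub, c, hn']
  obtain ⟨Y, ⟨-, hY⟩, hYX⟩ := hle (Submodule.mem_map_of_mem hX0)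
  have hYX' : k * Y * k⁻¹ = h * (X - c • (1 : Mn n)) * h⁻¹ := hYX
  have hkey : (k⁻¹ * h) * X * (h⁻¹ * k) = Y + c • (1 : Mn n) := by
    calc (k⁻¹ * h) * X * (h⁻¹ * k)
        = k⁻¹ * (h * (X - c • (1 : Mn n)) * h⁻¹) * k + c • (k⁻¹ * (h * h⁻¹) * k) := by
          simp only [Matrix.mul_sub, Matrix.sub_mul, Matrix.mul_smul, Matrix.smul_mul,
            Matrix.mul_one, Matrix.mul_assoc]
          abel
      _ = Y + c • (1 : Mn n) := by
          rw [← hYX', Matrix.mul_nonsing_inv _ hhu, Matrix.mul_one,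
            Matrix.nonsing_inv_mul _ hku, Matrix.mul_assoc k,
            Matrix.nonsing_inv_mul_cancel_left _ _ hku, Matrix.mul_assoc,
            Matrix.nonsing_inv_mul _ hku, Matrix.mul_one]
  rw [hkey]
  exact T.add_mem hY (T.smul_mem c hT)

/-- If two elements conjugate the traceless triangular matrices to the same subspace, then
their transition matrix acts trivially on diagonal parts. -/
theorem pi0_transition_pi0 {n : ℕ} (hn : n ≠ 0) {α : Type*} [LinearOrder α] {b : Fin n → α}
    (hb : Function.Injective b) {T : Submodule ℝ (Mn n)}
    (hT : ∀ X : Mn n, X ∈ T ↔ X.BlockTriangular b)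
    {h k : Mn n} (hh : h.det = 1) (hk : k.det = 1)
    (heq : (slSub n ⊓ T).map (AdM h) = (slSub n ⊓ T).map (AdM k)) (Z : Mn n) :
    pi0 ((k⁻¹ * h) * pi0 Z * (h⁻¹ * k)) = pi0 Z := by
  have hhu : IsUnit h.det := by simp [hh]
  have hku : IsUnit k.det := by simp [hk]
  have h1 : (1 : Mn n) ∈ T := (hT 1).2 Matrix.blockTriangular_one
  refine pi0_conj_pi0 hb ?_ ?_ ?_ Z
  · refine blockTriangular_of_conj_s8 (g' := h⁻¹ * k) ?_ fun X hX =>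
      (hT _).1 (conj_mem_of_map_le hn h1 hk hh heq.ge ((hT _).2 hX))
    simp [Matrix.det_nonsing_inv, hh, hk]
  · refine blockTriangular_of_conj_s8 (g' := k⁻¹ * h) ?_ fun X hX =>
      (hT _).1 (conj_mem_of_map_le hn h1 hh hk heq.le ((hT _).2 hX))
    simp [Matrix.det_nonsing_inv, hh, hk]
  · rw [Matrix.mul_assoc, Matrix.mul_nonsing_inv_cancel_left _ _ hhu,
      Matrix.nonsing_inv_mul _ hku]

/-- The composition identities for two elements conjugating the traceless triangular matrices
to the same subspace. -/
theorem nustar_nuMap_comp {n : ℕ} (hn : n ≠ 0) {α : Type*} [LinearOrder α] {b : Fin n → α}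
    (hb : Function.Injective b) {T : Submodule ℝ (Mn n)}
    (hT : ∀ X : Mn n, X ∈ T ↔ X.BlockTriangular b)
    {h k : Mn n} (hh : h.det = 1) (hk : k.det = 1)
    (heq : (slSub n ⊓ T).map (AdM h) = (slSub n ⊓ T).map (AdM k)) :
    nustar h = (nustar k).comp (piStd h) ∧ nuMap h = (piStd h).comp (nuMap k) := by
  have hhu : IsUnit h.det := by simp [hh]
  have hku : IsUnit k.det := by simp [hk]
  constructor
  · refine LinearMap.ext fun Z => ?_
    have := pi0_transition_pi0 hn hb hT hh hk heq (h⁻¹ * Z * h⁻¹⁻¹)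
    simp only [nustar, piStd, AdM, LinearMap.comp_apply, LinearMap.coe_mk, AddHom.coe_mk]
    refine this.symm.trans (congrArg _ ?_)
    simp only [Matrix.nonsing_inv_nonsing_inv _ hku, Matrix.mul_assoc]
  · refine LinearMap.ext fun Z => ?_
    have := pi0_transition_pi0 hn hb hT hk hh heq.symm Z
    simp only [nuMap, piStd, AdM, LinearMap.comp_apply, LinearMap.coe_mk, AddHom.coe_mk]
    refine congrArg (fun D => h * D * h⁻¹) (this.symm.trans (congrArg _ ?_))
    simp only [Matrix.nonsing_inv_nonsing_inv _ hhu, Matrix.mul_assoc]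

/-- Let V_i, V_j, V_k be pairwise transverse parabolic subspaces of
𝔰𝔩ₙ(ℝ), with standardizers for the ordered pairs (V_i,V_j), (V_i,V_k), (V_k,V_j). Then
ν*_{i,j} = ν*_{i,k} ∘ π_{i,j}, ν_{i,j} = π_{i,j} ∘ ν_{i,k}, ν*_{i,j} = ν*_{k,j} ∘ π_{i,j}
and ν_{i,j} = π_{i,j} ∘ ν_{k,j}. -/
theorem neutral_comap_composition_identities (n : ℕ) (hn : 2 ≤ n)
    (Vi Vj Vk : Submodule ℝ (Mn n))
    (hVi : IsParabolic Vi) (hVj : IsParabolic Vj) (hVk : IsParabolic Vk)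
    (hij' : Transv Vi Vj) (hik' : Transv Vi Vk) (hkj' : Transv Vk Vj)
    (hij hik hkj : Mn n)
    (h₁ : IsStd hij Vi Vj) (h₂ : IsStd hik Vi Vk) (h₃ : IsStd hkj Vk Vj) :
    (nustar hij = (nustar hik).comp (piStd hij)) ∧
    (nuMap hij = (piStd hij).comp (nuMap hik)) ∧
    (nustar hij = (nustar hkj).comp (piStd hij)) ∧
    (nuMap hij = (piStd hij).comp (nuMap hkj)) := by
  have hn0 : n ≠ 0 := by omega
  have hup := nustar_nuMap_comp hn0 Function.injective_id (T := upTri n)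
    (fun X => ⟨fun h i j => h i j, fun h i j => @h i j⟩) h₁.1 h₂.1 (h₁.2.1.trans h₂.2.1.symm)
  have hlo := nustar_nuMap_comp hn0 OrderDual.toDual.injective (T := loTri n)
    (fun X => ⟨fun h i j => h i j, fun h i j => @h i j⟩) h₁.1 h₃.1 (h₁.2.2.trans h₃.2.2.symm)
  exact ⟨hup.1, hup.2, hlo.1, hlo.2⟩

end
end

section
/- Let A₁, A₂, A₃, A₄ be pairwise transverse affine parabolic spaces in 𝔰𝔩ₙ(ℝ) and let Xᵢ ∈ Aᵢ be arbitrary points (i = 1,2,3,4). Then β(A₁,A₂,A₃,A₄) = (ν*_{1,4} − ν*_{1,3})X₁ + (ν*_{2,3} − ν*_{2,4})X₂ − (ν*_{2,3} − ν*_{1,3})X₃ − (ν*_{1,4} − ν*_{2,4})X₄. -/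
open Matrix

noncomputable section

/-- The diagonal of a product of triangular matrices is the product of the diagonals. -/
lemma Matrix.BlockTriangular.mul_apply_diag {ι α R : Type*} [Fintype ι]
    [LinearOrder α] [NonUnitalNonAssocSemiring R] {f : ι → α} (hf : Function.Injective f)
    {M N : Matrix ι ι R} (hM : M.BlockTriangular f) (hN : N.BlockTriangular f) (i : ι) :
    (M * N) i i = M i i * N i i := by
  rw [Matrix.mul_apply]
  refine Finset.sum_eq_single_of_mem i (Finset.mem_univ i) fun j _ hj => ?_
  rcases lt_or_gt_of_ne (hf.ne hj) with h | h
  · rw [hM h, zero_mul]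
  · rw [hN h, mul_zero]

/-- An invertible matrix whose conjugation action preserves triangularity of the elementary
triangular matrices is itself triangular. -/
lemma Matrix.blockTriangular_of_mul_eq_zero {ι α R : Type*} [Fintype ι] [DecidableEq ι]
    [LinearOrder α] [Field R] {f : ι → α} (hf : Function.Injective f)
    {u v : Matrix ι ι R} (hvu : v * u = 1)
    (H : ∀ a b i j, f a ≤ f b → f j < f i → u i a * v b j = 0) :
    u.BlockTriangular f := by
  classical
  by_contra hu
  let s : Finset ι := Finset.univ.filter fun i => ∃ a, f a < f i ∧ u i a ≠ 0
  have hs : s.Nonempty := by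
    simp only [Matrix.BlockTriangular, not_forall] at hu
    obtain ⟨i, a, hai, hne⟩ := hu
    exact ⟨i, by simpa [s] using ⟨a, hai, hne⟩⟩
  obtain ⟨i, his, hmax⟩ := s.exists_max_image f hs
  obtain ⟨a, hai, hne⟩ : ∃ a, f a < f i ∧ u i a ≠ 0 := by simpa [s] using his
  have hv : ∀ b j, f a ≤ f b → f j < f i → v b j = 0 := fun b j hb hj =>
    (mul_eq_zero.1 (H a b i j hb hj)).resolve_left hne
  have hbelow : ∀ j k, f i < f j → f k < f j → u j k = 0 := by
    intro j k hij hkj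
    by_contra hjk
    exact absurd (hmax j (by simpa [s] using ⟨k, hkj, hjk⟩)) (not_le.2 hij)
  have hrow : ∀ k, f k ≤ f i → (v * u) i k = v i i * u i k := by
    intro k hk
    rw [Matrix.mul_apply]
    refine Finset.sum_eq_single_of_mem i (Finset.mem_univ i) fun j _ hj => ?_
    rcases lt_or_gt_of_ne (hf.ne hj) with h | h
    · rw [hv i j hai.le h, zero_mul]
    · rw [hbelow j k h (hk.trans_lt h), mul_zero]
  have hia : i ≠ a := fun h => hai.ne (congrArg f h.symm)
  have hzero := hrow a hai.le
  rw [hvu, Matrix.one_apply_ne hia] at hzero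
  have hone := hrow i le_rfl
  rw [hvu, Matrix.one_apply_eq, (mul_eq_zero.1 hzero.symm).resolve_right hne, zero_mul] at hone
  exact one_ne_zero hone

/-- Conjugation by an element normalizing the traceless triangular matrices preserves the
diagonal of every triangular matrix. -/
lemma Matrix.BlockTriangular.conj_apply_diag {n : ℕ} {α : Type*} [LinearOrder α]
    {f : Fin n → α} (hf : Function.Injective f) {u v : Mn n} (huv : u * v = 1)
    (H : ∀ Z : Mn n, Z.trace = 0 → Z.BlockTriangular f → (u * Z * v).BlockTriangular f)
    {Z : Mn n} (hZ : Z.BlockTriangular f) (i : Fin n) : (u * Z * v) i i = Z i i := by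
  have hvu : v * u = 1 := mul_eq_one_comm.1 huv
  have hn : (n : ℝ) ≠ 0 := Nat.cast_ne_zero.2 i.pos.ne'
  have hconj : ∀ Y : Mn n, Y.BlockTriangular f → (u * Y * v).BlockTriangular f := by
    intro Y hY
    have hc : (Y - (Y.trace / n) • (1 : Mn n)).BlockTriangular f :=
      hY.sub (by
        intro a b hab
        have : a ≠ b := fun h => hab.ne (congrArg f h.symm)
        simp [Matrix.one_apply_ne this])
    have ht : (Y - (Y.trace / n) • (1 : Mn n)).trace = 0 := by
      simp [Matrix.trace_sub, Matrix.trace_smul, hn]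
    intro a b hab
    have hne : a ≠ b := fun h => hab.ne (congrArg f h.symm)
    have := H _ ht hc hab
    simpa [mul_sub, sub_mul, huv, Matrix.one_apply_ne hne] using this
  have hu : u.BlockTriangular f := by
    refine Matrix.blockTriangular_of_mul_eq_zero hf hvu fun a b i j hab hji => ?_
    have hS : (Matrix.single a b (1 : ℝ)).BlockTriangular f := by
      intro k l hlk
      refine Matrix.single_apply_of_ne _ _ _ _ _ ?_
      rintro ⟨rfl, rfl⟩
      exact absurd hab (not_le.2 hlk)
    have := hconj _ hS hji
    rw [Matrix.mul_apply, Finset.sum_eq_single_of_mem b (Finset.mem_univ b)] at this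
    · simpa using this
    · intro k _ hk
      simp [Matrix.mul_single_apply_of_ne, hk]
  have hv : v.BlockTriangular f := by
    have : Invertible u := ⟨v, hvu, huv⟩
    rw [← Matrix.inv_eq_right_inv huv]
    exact Matrix.blockTriangular_inv_of_blockTriangular hu
  have h1 : u i i * v i i = 1 := by
    rw [← hu.mul_apply_diag hf hv, huv, Matrix.one_apply_eq]
  rw [(hu.mul hZ).mul_apply_diag hf hv, hu.mul_apply_diag hf hZ, mul_right_comm, h1, one_mul]

/-- If `h` and `h'` conjugate the traceless triangular matrices onto the same subspace, then
`nustar h` and `nustar h'` agree on that subspace. -/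
lemma nustar_eq_of_map_eq {n : ℕ} {α : Type*} [LinearOrder α] {f : Fin n → α}
    (hf : Function.Injective f) {S V : Submodule ℝ (Mn n)}
    (hS : ∀ Z, Z ∈ S ↔ Z.trace = 0 ∧ Z.BlockTriangular f) {h h' : Mn n}
    (hd : h.det = 1) (hd' : h'.det = 1) (hV : S.map (AdM h) = V) (hV' : S.map (AdM h') = V)
    {X : Mn n} (hX : X ∈ V) : nustar h X = nustar h' X := by
  have hu : IsUnit h.det := by simp [hd]
  have hu' : IsUnit h'.det := by simp [hd']
  have hr : h⁻¹ * h = 1 := Matrix.nonsing_inv_mul h hu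
  have hl : h * h⁻¹ = 1 := Matrix.mul_nonsing_inv h hu
  have hr' : h'⁻¹ * h' = 1 := Matrix.nonsing_inv_mul h' hu'
  have cancel : ∀ {g k : Mn n}, g * k = 1 → ∀ Z, g * (k * Z * g) * k = Z := by
    intro g k hgk Z
    rw [show g * (k * Z * g) * k = (g * k) * Z * (g * k) by simp only [mul_assoc], hgk, one_mul,
      mul_one]
  obtain ⟨Z, hZ, rfl⟩ := hV ▸ hX
  have huv : (h'⁻¹ * h) * (h⁻¹ * h') = 1 := by
    rw [mul_assoc, ← mul_assoc h, hl, one_mul, hr']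
  have H : ∀ Y : Mn n, Y.trace = 0 → Y.BlockTriangular f →
      (h'⁻¹ * h * Y * (h⁻¹ * h')).BlockTriangular f := by
    intro Y hY hYf
    have hmem : AdM h Y ∈ S.map (AdM h') := by
      rw [hV', ← hV]
      exact Submodule.mem_map_of_mem ((hS Y).2 ⟨hY, hYf⟩)
    obtain ⟨W, hW, hWY⟩ := hmem
    have hWY : h' * W * h'⁻¹ = h * Y * h⁻¹ := hWY
    have : h'⁻¹ * h * Y * (h⁻¹ * h') = W := by
      rw [← cancel hr' W, hWY]
      simp only [mul_assoc]
    exact this ▸ ((hS W).1 hW).2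
  have hdiag := ((hS Z).1 hZ).2.conj_apply_diag hf huv H
  have e : AdM h⁻¹ (AdM h Z) = Z := by
    change h⁻¹ * (h * Z * h⁻¹) * h⁻¹⁻¹ = Z
    rw [Matrix.nonsing_inv_nonsing_inv h hu]
    exact cancel hr Z
  have e' : AdM h'⁻¹ (AdM h Z) = h'⁻¹ * h * Z * (h⁻¹ * h') := by
    change h'⁻¹ * (h * Z * h⁻¹) * h'⁻¹⁻¹ = _
    rw [Matrix.nonsing_inv_nonsing_inv h' hu']
    simp only [mul_assoc]
  change pi0 (AdM h⁻¹ (AdM h Z)) = pi0 (AdM h'⁻¹ (AdM h Z))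
  rw [e, e']
  exact congrArg Matrix.diagonal (funext fun i => (hdiag i).symm)

lemma nustar_eq_of_fst {n : ℕ} {h h' : Mn n} {V W W' : Submodule ℝ (Mn n)}
    (std : IsStd h V W) (std' : IsStd h' V W') {X : Mn n} (hX : X ∈ V) :
    nustar h X = nustar h' X :=
  nustar_eq_of_map_eq (f := id) (S := bplus n) Function.injective_id
    (fun _ => ⟨fun hZ => ⟨hZ.1, fun i j => hZ.2 i j⟩, fun hZ => ⟨hZ.1, fun _ _ hij => hZ.2 hij⟩⟩)
    std.1 std'.1 std.2.1 std'.2.1 hX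

lemma nustar_eq_of_snd {n : ℕ} {h h' : Mn n} {V V' W : Submodule ℝ (Mn n)}
    (std : IsStd h V W) (std' : IsStd h' V' W) {X : Mn n} (hX : X ∈ W) :
    nustar h X = nustar h' X :=
  nustar_eq_of_map_eq (f := OrderDual.toDual) (S := bminus n) OrderDual.toDual.injective
    (fun _ => ⟨fun hZ => ⟨hZ.1, fun i j hij => hZ.2 i j hij⟩,
      fun hZ => ⟨hZ.1, fun _ _ hij => hZ.2 hij⟩⟩)
    std.1 std'.1 std.2.2 std'.2.2 hX

/-- `nustar h` does not depend on the standardizer `h` of a transverse pair. -/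
lemma nustar_eq_of_isStd {n : ℕ} {h h' : Mn n} {V W : Submodule ℝ (Mn n)} (t : Transv V W)
    (std : IsStd h V W) (std' : IsStd h' V W) {X : Mn n} (hX : X ∈ slSub n) :
    nustar h X = nustar h' X := by
  obtain ⟨Y, hY, Z, hZ, rfl⟩ := Submodule.mem_sup.1 (t.symm ▸ hX : X ∈ V ⊔ W)
  rw [map_add, map_add, nustar_eq_of_fst std std' hY, nustar_eq_of_snd std std' hZ]

lemma IsAffPara.sub_mem {n : ℕ} {A : Set (Mn n)} {V : Submodule ℝ (Mn n)} (hA : IsAffPara A V)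
    {X Y : Mn n} (hX : X ∈ A) (hY : Y ∈ A) : X - Y ∈ V := by
  obtain ⟨-, P, -, rfl⟩ := hA
  simpa using V.sub_mem hX hY

lemma IsAffPara.mem_slSub {n : ℕ} {A : Set (Mn n)} {V : Submodule ℝ (Mn n)}
    (hA : IsAffPara A V) (hV : V ≤ slSub n) {X : Mn n} (hX : X ∈ A) : X ∈ slSub n := by
  obtain ⟨-, P, hP, rfl⟩ := hA
  simpa using (slSub n).add_mem (hV hX) hP

/-- Let A₁, A₂, A₃, A₄ be pairwise transverse affine parabolic spaces
and Xᵢ ∈ Aᵢ arbitrary points. Then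
β(A₁,A₂,A₃,A₄) = (ν*_{1,4} − ν*_{1,3})X₁ + (ν*_{2,3} − ν*_{2,4})X₂
               − (ν*_{2,3} − ν*_{1,3})X₃ − (ν*_{1,4} − ν*_{2,4})X₄. -/
theorem affine_cross_ratio_from_arbitrary_points (n : ℕ) (hn : 2 ≤ n)
    (A₁ A₂ A₃ A₄ : Set (Mn n)) (V₁ V₂ V₃ V₄ : Submodule ℝ (Mn n))
    (h₁ : IsAffPara A₁ V₁) (h₂ : IsAffPara A₂ V₂)
    (h₃ : IsAffPara A₃ V₃) (h₄ : IsAffPara A₄ V₄)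
    (t₁₂ : Transv V₁ V₂) (t₁₃ : Transv V₁ V₃) (t₁₄ : Transv V₁ V₄)
    (t₂₃ : Transv V₂ V₃) (t₂₄ : Transv V₂ V₄) (t₃₄ : Transv V₃ V₄) :
    ∀ b : Mn n, IsCross b A₁ A₂ A₃ A₄ V₁ V₂ V₃ V₄ →
    ∀ X₁ ∈ A₁, ∀ X₂ ∈ A₂, ∀ X₃ ∈ A₃, ∀ X₄ ∈ A₄,
    ∀ h₁₄ h₁₃ h₂₃ h₂₄ : Mn n,
      IsStd h₁₄ V₁ V₄ → IsStd h₁₃ V₁ V₃ → IsStd h₂₃ V₂ V₃ → IsStd h₂₄ V₂ V₄ →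
      b = (nustar h₁₄ X₁ - nustar h₁₃ X₁) + (nustar h₂₃ X₂ - nustar h₂₄ X₂)
        - (nustar h₂₃ X₃ - nustar h₁₃ X₃) - (nustar h₁₄ X₄ - nustar h₂₄ X₄) := by
  rintro b ⟨k₁₄, k₂₃, X₁₃, X₂₄, sk₁₄, sk₂₃, ⟨m₁, m₃⟩, ⟨m₂, m₄⟩, rfl⟩
    X₁ hX₁ X₂ hX₂ X₃ hX₃ X₄ hX₄ h₁₄ h₁₃ h₂₃ h₂₄ s₁₄ s₁₃ s₂₃ s₂₄
  have hsl : X₁₃ - X₂₄ ∈ slSub n :=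
    (slSub n).sub_mem (h₁.mem_slSub (t₁₂ ▸ le_sup_left) m₁)
      (h₂.mem_slSub (t₁₂ ▸ le_sup_right) m₂)
  rw [nustar_eq_of_isStd t₁₄ sk₁₄ s₁₄ hsl, nustar_eq_of_isStd t₂₃ sk₂₃ s₂₃ hsl]
  have e₁ := nustar_eq_of_fst s₁₄ s₁₃ (h₁.sub_mem hX₁ m₁)
  have e₂ := nustar_eq_of_fst s₂₃ s₂₄ (h₂.sub_mem hX₂ m₂)
  have e₃ := nustar_eq_of_snd s₂₃ s₁₃ (h₃.sub_mem hX₃ m₃)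
  have e₄ := nustar_eq_of_snd s₁₄ s₂₄ (h₄.sub_mem hX₄ m₄)
  simp only [map_sub] at e₁ e₂ e₃ e₄ ⊢
  linear_combination (norm := module) e₃ + e₄ - e₁ - e₂

end
end
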